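/- Let C_b = inf over nonzero φ ∈ H¹(ℝ²) of (‖∇φ‖₂² ‖φ‖₂²)/‖φ‖₄⁴. Then for all φ₁, φ₀, φ₋₁ ∈ H¹(ℝ²), ∫_{ℝ²} (|φ₁|²+|φ₀|²+|φ₋₁|²)² dx ≤ (1/C_b) ∫_{ℝ²} (|∇φ₁|²+|∇φ₀|²+|∇φ₋₁|²) dx · ∫_{ℝ²} (|φ₁|²+|φ₀|²+|φ₋₁|²) dx. -/

import Mathlib

open MeasureTheory Complex

noncomputable section

abbrev R2 := EuclideanSpace ℝ (Fin 2)

/-- Squared norm of the (classical) gradient of `f` at `x`. -/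
def gradsq2 (f : R2 → ℂ) (x : R2) : ℝ :=
  ∑ j : Fin 2, ‖fderiv ℝ f x (EuclideanSpace.single j 1)‖ ^ 2

/-- Membership in `H¹(ℝ²)` (plus `L⁴`, guaranteed by Gagliardo–Nirenberg). -/
def InH1 (f : R2 → ℂ) : Prop :=
  Differentiable ℝ f ∧ Integrable (fun x => ‖f x‖ ^ 2) ∧
    Integrable (fun x => gradsq2 f x) ∧ Integrable (fun x => ‖f x‖ ^ 4)

/-- The best constant in the 2D Gagliardo–Nirenberg inequality:
`C_b = inf { ‖∇φ‖₂²‖φ‖₂²/‖φ‖₄⁴ : 0 ≠ φ ∈ H¹(ℝ²) }`. -/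
def Cb : ℝ :=
  sInf {t : ℝ | ∃ f : R2 → ℂ, InH1 f ∧ ¬ (f =ᵐ[volume] 0) ∧
    t = (∫ x, gradsq2 f x) * (∫ x, ‖f x‖ ^ 2) / ∫ x, ‖f x‖ ^ 4}

/-- One-dimensional bound: a decaying function is bounded by the integral of its derivative. -/
lemma aux_one_dim (g g' : ℝ → ℝ) (hd : ∀ x, HasDerivAt g (g' x) x)
    (hg : Integrable g) (hg' : Integrable g') (x : ℝ) :
    ‖g x‖ₑ ≤ ∫⁻ t, ‖g' t‖ₑ := by
  have ht := tendsto_zero_of_hasDerivAt_of_integrableOn_Iic (a := x)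
    (fun y _ => hd y) hg'.integrableOn hg.integrableOn
  have h := integral_Iic_of_hasDerivAt_of_tendsto (a := x)
    (hd x).continuousAt.continuousWithinAt (fun y _ => hd y) hg'.integrableOn ht
  rw [sub_zero] at h
  rw [← h]
  exact (enorm_integral_le_lintegral_enorm _).trans (setLIntegral_le_lintegral _ _)

/-- Ladyzhenskaya-type product bound on `ℝ × ℝ`. -/
lemma aux_prod (g gx gy : ℝ × ℝ → ℝ) 
    (hx : ∀ x y, HasDerivAt (fun t => g (t, y)) (gx (x, y)) x)
    (hy : ∀ x y, HasDerivAt (fun t => g (x, t)) (gy (x, y)) y)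
    (ig : Integrable g) (igx : Integrable gx) (igy : Integrable gy) :
    ∫⁻ p, ‖g p‖ₑ ^ 2 ≤ (∫⁻ p, ‖gx p‖ₑ) * ∫⁻ p, ‖gy p‖ₑ := by
  rw [Measure.volume_eq_prod] at *
  have hA : ∀ᵐ y : ℝ, ∀ x, ‖g (x, y)‖ₑ ≤ ∫⁻ t, ‖gx (t, y)‖ₑ := by
    filter_upwards [ig.prod_left_ae, igx.prod_left_ae] with y h1 h2 x
    exact aux_one_dim (fun t => g (t, y)) (fun t => gx (t, y)) (fun x => hx x y) h1 h2 x
  have hB : ∀ᵐ x : ℝ, ∀ y, ‖g (x, y)‖ₑ ≤ ∫⁻ t, ‖gy (x, t)‖ₑ := by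
    filter_upwards [ig.prod_right_ae, igy.prod_right_ae] with x h1 h2 y
    exact aux_one_dim (fun t => g (x, t)) (fun t => gy (x, t)) (fun y => hy x y) h1 h2 y
  have hA' := (Measure.quasiMeasurePreserving_snd (μ := (volume : Measure ℝ))
    (ν := (volume : Measure ℝ))).ae hA
  have hB' := (Measure.quasiMeasurePreserving_fst (μ := (volume : Measure ℝ))
    (ν := (volume : Measure ℝ))).ae hB
  have mx : AEMeasurable (fun p => ‖gx p‖ₑ) ((volume : Measure ℝ).prod volume) :=
    igx.aestronglyMeasurable.enorm
  have my : AEMeasurable (fun p => ‖gy p‖ₑ) ((volume : Measure ℝ).prod volume) :=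
    igy.aestronglyMeasurable.enorm
  calc ∫⁻ p, ‖g p‖ₑ ^ 2 ∂((volume : Measure ℝ).prod volume)
      ≤ ∫⁻ p : ℝ × ℝ, (∫⁻ t, ‖gy (p.1, t)‖ₑ) * (∫⁻ t, ‖gx (t, p.2)‖ₑ)
          ∂((volume : Measure ℝ).prod volume) := by
        apply lintegral_mono_ae
        filter_upwards [hA', hB'] with p h1 h2
        rw [sq]
        exact mul_le_mul' (h2 p.2) (h1 p.1)
    _ = (∫⁻ x, ∫⁻ t, ‖gy (x, t)‖ₑ) * (∫⁻ y, ∫⁻ t, ‖gx (t, y)‖ₑ) := by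
        refine lintegral_prod_mul my.lintegral_prod_right' mx.lintegral_prod_left'
    _ = _ := by
        rw [lintegral_prod _ my, lintegral_prod_symm _ mx, mul_comm]

/-- Cauchy–Schwarz for integrals. -/
lemma aux_cs {α : Type*} [MeasurableSpace α] (μ : Measure α) (a b : α → ℝ)
    (ha : Integrable (fun x => a x ^ 2) μ) (hb : Integrable (fun x => b x ^ 2) μ)
    (hab : Integrable (fun x => a x * b x) μ) :
    (∫ x, a x * b x ∂μ) ^ 2 ≤ (∫ x, a x ^ 2 ∂μ) * ∫ x, b x ^ 2 ∂μ := by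
  have key : ∀ t : ℝ, 0 ≤ (∫ x, b x ^ 2 ∂μ) * (t * t) + (2 * ∫ x, a x * b x ∂μ) * t
      + ∫ x, a x ^ 2 ∂μ := by
    intro t
    have h0 : 0 ≤ ∫ x, (a x + t * b x) ^ 2 ∂μ := integral_nonneg fun x => sq_nonneg _
    have e : (fun x => (a x + t * b x) ^ 2)
        = fun x => (a x ^ 2 + (2 * t) * (a x * b x)) + (t * t) * b x ^ 2 := by
      funext x; ring
    rw [e, integral_add (ha.fun_add (hab.const_mul _)) (hb.const_mul _),
      integral_add ha (hab.const_mul _), integral_const_mul, integral_const_mul] at h0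
    linarith
  have := discrim_le_zero key
  rw [discrim] at this
  linarith

/-- Coordinates on the plane. -/
def planeMap (p : ℝ × ℝ) : R2 :=
  p.1 • EuclideanSpace.single 0 1 + p.2 • EuclideanSpace.single 1 1

lemma planeMap_mp : MeasurePreserving planeMap := by
  have h := (PiLp.volume_preserving_toLp (Fin 2)).comp
    ((volume_preserving_finTwoArrow ℝ).symm MeasurableEquiv.finTwoArrow)
  convert! h using 1
  funext p
  ext i
  fin_cases i <;> simp [planeMap, MeasurableEquiv.finTwoArrow]

/-- Scalar inequality with an explicit constant. -/
lemma aux_gn (f : R2 → ℂ) (hf : InH1 f) :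
    ∫ x, ‖f x‖ ^ 4 ≤ 2 * ((∫ x, gradsq2 f x) * ∫ x, ‖f x‖ ^ 2) := by
  obtain ⟨hd, i2, iG, i4⟩ := hf
  set e : Fin 2 → R2 := fun j => EuclideanSpace.single j 1 with he
  have mf : Measurable f := hd.continuous.measurable
  have md : ∀ j, Measurable fun x => fderiv ℝ f x (e j) :=
    fun j => measurable_fderiv_apply_const ℝ f (e j)
  have hle : ∀ j x, ‖fderiv ℝ f x (e j)‖ ^ 2 ≤ gradsq2 f x := by
    intro j x
    exact Finset.single_le_sum (f := fun j => ‖fderiv ℝ f x (e j)‖ ^ 2)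
      (fun _ _ => by positivity) (Finset.mem_univ j)
  have iD : ∀ j, Integrable fun x => ‖fderiv ℝ f x (e j)‖ ^ 2 := by
    intro j
    refine iG.mono' ((md j).norm.pow_const 2).aestronglyMeasurable (.of_forall fun x => ?_)
    rw [Real.norm_of_nonneg (by positivity)]
    exact hle j x
  have iP : ∀ j, Integrable fun x => ‖f x‖ * ‖fderiv ℝ f x (e j)‖ := by
    intro j
    refine (i2.add (iD j)).mono' (mf.norm.mul (md j).norm).aestronglyMeasurable
      (.of_forall fun x => ?_)
    rw [Real.norm_of_nonneg (by positivity)]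
    simp only [Pi.add_apply]
    nlinarith [sq_nonneg (‖f x‖ - ‖fderiv ℝ f x (e j)‖), sq_nonneg (‖f x‖),
      sq_nonneg (‖fderiv ℝ f x (e j)‖)]
  set q : Fin 2 → R2 → ℝ := fun j x => 2 * inner ℝ (f x) (fderiv ℝ f x (e j)) with hq
  have hqle : ∀ j x, ‖q j x‖ ≤ 2 * (‖f x‖ * ‖fderiv ℝ f x (e j)‖) := by
    intro j x
    simp only [hq, norm_mul, Real.norm_ofNat]
    gcongr
    exact norm_inner_le_norm _ _
  have iq : ∀ j, Integrable (q j) := by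
    intro j
    refine ((iP j).const_mul 2).mono' ?_ (.of_forall (hqle j))
    exact ((mf.inner (md j)).const_mul 2).aestronglyMeasurable
  have hq1 : ∀ j, (∫ x, ‖q j x‖) ^ 2 ≤
      4 * ((∫ x, ‖f x‖ ^ 2) * ∫ x, ‖fderiv ℝ f x (e j)‖ ^ 2) := by
    intro j
    have h1 : ∫ x, ‖q j x‖ ≤ 2 * ∫ x, ‖f x‖ * ‖fderiv ℝ f x (e j)‖ := by
      rw [← integral_const_mul]
      exact integral_mono (iq j).norm ((iP j).const_mul 2) (hqle j)
    have h2 := aux_cs volume (fun x => ‖f x‖) (fun x => ‖fderiv ℝ f x (e j)‖) i2 (iD j) (iP j)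
    have h0 : 0 ≤ ∫ x, ‖q j x‖ := integral_nonneg fun x => norm_nonneg _
    calc (∫ x, ‖q j x‖) ^ 2 ≤ (2 * ∫ x, ‖f x‖ * ‖fderiv ℝ f x (e j)‖) ^ 2 := by gcongr
      _ ≤ _ := by linarith
  have hG : ∫ x, gradsq2 f x = (∫ x, ‖fderiv ℝ f x (e 0)‖ ^ 2)
      + ∫ x, ‖fderiv ℝ f x (e 1)‖ ^ 2 := by
    rw [← integral_add (iD 0) (iD 1)]
    simp [gradsq2, he, Fin.sum_univ_two]
  -- the two-dimensional bound
  have mp := planeMap_mp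
  have hline0 : ∀ x y : ℝ, HasDerivAt (fun t => planeMap (t, y)) (e 0) x := by
    intro x y
    simpa [planeMap] using
      ((hasDerivAt_id x).smul_const (e 0)).add_const (y • e 1)
  have hline1 : ∀ x y : ℝ, HasDerivAt (fun t => planeMap (x, t)) (e 1) y := by
    intro x y
    simpa [planeMap] using
      ((hasDerivAt_id y).smul_const (e 1)).const_add (x • e 0)
  have key := aux_prod (fun p => ‖f (planeMap p)‖ ^ 2) (fun p => q 0 (planeMap p))
    (fun p => q 1 (planeMap p))
    (fun x y => ((hd _).hasFDerivAt.comp_hasDerivAt x (hline0 x y)).norm_sq)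
    (fun x y => ((hd _).hasFDerivAt.comp_hasDerivAt y (hline1 x y)).norm_sq)
    (mp.integrable_comp_of_integrable i2) (mp.integrable_comp_of_integrable (iq 0))
    (mp.integrable_comp_of_integrable (iq 1))
  have mq : ∀ j, Measurable (q j) := fun j => (mf.inner (md j)).const_mul 2
  rw [mp.lintegral_comp (f := fun x => ‖‖f x‖ ^ 2‖ₑ ^ 2) (by fun_prop),
    mp.lintegral_comp (f := fun x => ‖q 0 x‖ₑ) (mq 0).enorm,
    mp.lintegral_comp (f := fun x => ‖q 1 x‖ₑ) (mq 1).enorm,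
    ← ofReal_integral_norm_eq_lintegral_enorm (iq 0),
    ← ofReal_integral_norm_eq_lintegral_enorm (iq 1)] at key
  have e4 : ∫⁻ x, ‖‖f x‖ ^ 2‖ₑ ^ 2 = ENNReal.ofReal (∫ x, ‖f x‖ ^ 4) := by
    rw [ofReal_integral_eq_lintegral_ofReal i4 (.of_forall fun x => by positivity)]
    refine lintegral_congr fun x => ?_
    rw [Real.enorm_of_nonneg (by positivity), ← ENNReal.ofReal_pow (by positivity)]
    congr 1; ring
  have n0 : 0 ≤ ∫ x, ‖q 0 x‖ := integral_nonneg fun x => norm_nonneg _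
  have n1 : 0 ≤ ∫ x, ‖q 1 x‖ := integral_nonneg fun x => norm_nonneg _
  rw [e4, ← ENNReal.ofReal_mul n0, ENNReal.ofReal_le_ofReal_iff (mul_nonneg n0 n1)] at key
  rw [hG]
  nlinarith [hq1 0, hq1 1, sq_nonneg ((∫ x, ‖q 0 x‖) - ∫ x, ‖q 1 x‖)]

lemma gradsq2_nonneg (f : R2 → ℂ) (x : R2) : 0 ≤ gradsq2 f x :=
  Finset.sum_nonneg fun _ _ => by positivity

lemma int_four_pos (f : R2 → ℂ) (hf : InH1 f) (hne : ¬ (f =ᵐ[volume] 0)) :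
    0 < ∫ x, ‖f x‖ ^ 4 := by
  refine lt_of_le_of_ne (integral_nonneg fun x => by positivity) fun h => hne ?_
  have := (integral_eq_zero_iff_of_nonneg (fun x => by positivity) hf.2.2.2).1 h.symm
  filter_upwards [this] with x hx
  simpa using hx

lemma Cb_pos (f : R2 → ℂ) (hf : InH1 f) (hne : ¬ (f =ᵐ[volume] 0)) : 0 < Cb := by
  refine lt_of_lt_of_le (by norm_num : (0 : ℝ) < 1 / 2) ?_
  refine le_csInf ⟨_, f, hf, hne, rfl⟩ ?_
  rintro t ⟨g, hg, hgne, rfl⟩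
  rw [le_div_iff₀ (int_four_pos g hg hgne)]
  linarith [aux_gn g hg]

lemma Cb_mul_le (f : R2 → ℂ) (hf : InH1 f) :
    Cb * (∫ x, ‖f x‖ ^ 4) ≤ (∫ x, gradsq2 f x) * ∫ x, ‖f x‖ ^ 2 := by
  by_cases hne : f =ᵐ[volume] 0
  · have : ∫ x, ‖f x‖ ^ 4 = 0 := by
      apply integral_eq_zero_of_ae
      filter_upwards [hne] with x hx
      simp [hx]
    rw [this, mul_zero]
    exact mul_nonneg (integral_nonneg (gradsq2_nonneg f)) (integral_nonneg fun x => by positivity)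
  · rw [← le_div_iff₀ (int_four_pos f hf hne)]
    refine csInf_le ⟨0, ?_⟩ ⟨f, hf, hne, rfl⟩
    rintro t ⟨g, hg, hgne, rfl⟩
    exact div_nonneg (mul_nonneg (integral_nonneg (gradsq2_nonneg g))
      (integral_nonneg fun x => by positivity)) (integral_nonneg fun x => by positivity)

lemma int_cross (f g : R2 → ℂ) (hf : InH1 f) (hg : InH1 g) :
    Integrable fun x => ‖f x‖ ^ 2 * ‖g x‖ ^ 2 := by
  have mf : Measurable f := hf.1.continuous.measurable
  have mg : Measurable g := hg.1.continuous.measurable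
  refine (hf.2.2.2.add hg.2.2.2).mono' (by fun_prop) (.of_forall fun x => ?_)
  rw [Real.norm_of_nonneg (by positivity)]
  simp only [Pi.add_apply]
  nlinarith [sq_nonneg (‖f x‖ ^ 2 - ‖g x‖ ^ 2), sq_nonneg (‖f x‖ ^ 2), sq_nonneg (‖g x‖ ^ 2)]

lemma cross_le (f g : R2 → ℂ) (hf : InH1 f) (hg : InH1 g) (hc : 0 ≤ Cb) :
    2 * (Cb * ∫ x, ‖f x‖ ^ 2 * ‖g x‖ ^ 2) ≤
      (∫ x, gradsq2 f x) * (∫ x, ‖g x‖ ^ 2) + (∫ x, gradsq2 g x) * ∫ x, ‖f x‖ ^ 2 := by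
  have h := aux_cs volume (fun x => ‖f x‖ ^ 2) (fun x => ‖g x‖ ^ 2)
    (by simpa [← pow_mul] using hf.2.2.2) (by simpa [← pow_mul] using hg.2.2.2)
    (int_cross f g hf hg)
  simp only [← pow_mul] at h
  norm_num at h
  have hf1 := Cb_mul_le f hf
  have hg1 := Cb_mul_le g hg
  have a1 : 0 ≤ ∫ x, gradsq2 f x := integral_nonneg (gradsq2_nonneg f)
  have a2 : 0 ≤ ∫ x, gradsq2 g x := integral_nonneg (gradsq2_nonneg g)
  have b1 : 0 ≤ ∫ x, ‖f x‖ ^ 2 := integral_nonneg fun x => by positivity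
  have b2 : 0 ≤ ∫ x, ‖g x‖ ^ 2 := integral_nonneg fun x => by positivity
  have d1 : 0 ≤ ∫ x, ‖f x‖ ^ 4 := integral_nonneg fun x => by positivity
  have d2 : 0 ≤ ∫ x, ‖g x‖ ^ 4 := integral_nonneg fun x => by positivity
  generalize (∫ x, ‖f x‖ ^ 2 * ‖g x‖ ^ 2) = J at *
  generalize (∫ x, gradsq2 f x) = A at *
  generalize (∫ x, gradsq2 g x) = B at *
  generalize (∫ x, ‖f x‖ ^ 2) = M at *
  generalize (∫ x, ‖g x‖ ^ 2) = N at *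
  generalize (∫ x, ‖f x‖ ^ 4) = P at *
  generalize (∫ x, ‖g x‖ ^ 4) = Q at *
  refine le_of_sq_le_sq ?_ (by positivity)
  have h1 : Cb ^ 2 * J ^ 2 ≤ Cb ^ 2 * (P * Q) := by gcongr
  have h2 : (Cb * P) * (Cb * Q) ≤ (A * M) * (B * N) := by gcongr
  nlinarith [sq_nonneg (A * N - B * M)]

/-- Three-component Gagliardo–Nirenberg inequality in 2D. -/
theorem stmt4 (φ1 φ0 φm1 : R2 → ℂ)
    (h1 : InH1 φ1) (h0 : InH1 φ0) (hm1 : InH1 φm1) :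
    (∫ x, (‖φ1 x‖ ^ 2 + ‖φ0 x‖ ^ 2 + ‖φm1 x‖ ^ 2) ^ 2)
      ≤ (1 / Cb) * ((∫ x, (gradsq2 φ1 x + gradsq2 φ0 x + gradsq2 φm1 x)) *
          ∫ x, (‖φ1 x‖ ^ 2 + ‖φ0 x‖ ^ 2 + ‖φm1 x‖ ^ 2)) := by
  by_cases hz : φ1 =ᵐ[volume] 0 ∧ φ0 =ᵐ[volume] 0 ∧ φm1 =ᵐ[volume] 0
  · obtain ⟨z1, z2, z3⟩ := hz
    have : ∫ x, (‖φ1 x‖ ^ 2 + ‖φ0 x‖ ^ 2 + ‖φm1 x‖ ^ 2) ^ 2 = 0 := by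
      apply integral_eq_zero_of_ae
      filter_upwards [z1, z2, z3] with x e1 e2 e3
      simp [e1, e2, e3]
    rw [this]
    have hM : ∫ x, (‖φ1 x‖ ^ 2 + ‖φ0 x‖ ^ 2 + ‖φm1 x‖ ^ 2) = 0 := by
      apply integral_eq_zero_of_ae
      filter_upwards [z1, z2, z3] with x e1 e2 e3
      simp [e1, e2, e3]
    rw [hM]
    simp
  · have hc : 0 < Cb := by
      by_cases z1 : φ1 =ᵐ[volume] 0
      · by_cases z2 : φ0 =ᵐ[volume] 0
        · exact Cb_pos φm1 hm1 fun z3 => hz ⟨z1, z2, z3⟩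
        · exact Cb_pos φ0 h0 z2
      · exact Cb_pos φ1 h1 z1
    have e : (fun x => (‖φ1 x‖ ^ 2 + ‖φ0 x‖ ^ 2 + ‖φm1 x‖ ^ 2) ^ 2) = fun x =>
        ((‖φ1 x‖ ^ 4 + ‖φ0 x‖ ^ 4) + ‖φm1 x‖ ^ 4) + 2 * ((‖φ1 x‖ ^ 2 * ‖φ0 x‖ ^ 2
          + ‖φ1 x‖ ^ 2 * ‖φm1 x‖ ^ 2) + ‖φ0 x‖ ^ 2 * ‖φm1 x‖ ^ 2) := by
      funext x; ring
    have j1 := int_cross φ1 φ0 h1 h0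
    have j2 := int_cross φ1 φm1 h1 hm1
    have j3 := int_cross φ0 φm1 h0 hm1
    rw [e, integral_add ((h1.2.2.2.fun_add h0.2.2.2).fun_add hm1.2.2.2)
        (((j1.fun_add j2).fun_add j3).const_mul 2),
      integral_add (h1.2.2.2.fun_add h0.2.2.2) hm1.2.2.2, integral_add h1.2.2.2 h0.2.2.2,
      integral_const_mul, integral_add (j1.fun_add j2) j3, integral_add j1 j2,
      integral_add (h1.2.2.1.fun_add h0.2.2.1) hm1.2.2.1, integral_add h1.2.2.1 h0.2.2.1,
      integral_add (h1.2.1.fun_add h0.2.1) hm1.2.1, integral_add h1.2.1 h0.2.1,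
      one_div, inv_mul_eq_div, le_div_iff₀ hc]
    linarith [Cb_mul_le φ1 h1, Cb_mul_le φ0 h0, Cb_mul_le φm1 hm1,
      cross_le φ1 φ0 h1 h0 hc.le, cross_le φ1 φm1 h1 hm1 hc.le, cross_le φ0 φm1 h0 hm1 hc.le]

end
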